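/- arXiv:1001.5404 — 3 statements merged into one kernel-verified Lean document; each statement's English description precedes it below -/
import Mathlib

section
/- If m : L → S is a term graph morphism and σ_m is the substitution induced by m, then term(L) instantiated by σ_m equals term(S), i.e. term(L)σ_m = term(S). -/
namespace TermGraphs

/-- First-order terms over a signature `F` and variables `V`. -/
inductive Tm (F V : Type) : Type
  | var : V → Tm F V
  | app : F → List (Tm F V) → Tm F V

/-- A (pre-)graph over labels `L`: a finite set of nodes (drawn from `ℕ`),
a successor map assigning each node an ordered sequence of nodes,
a labelling, and a designated root node. -/
structure PreGraph (L : Type) where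
  nodes : Finset ℕ
  suc : ℕ → List ℕ
  lab : ℕ → L
  root : ℕ

variable {F V L : Type}

/-- The edge relation of a graph: `u → v` iff `v` occurs in `suc u`. -/
def Edge (G : PreGraph L) (u v : ℕ) : Prop := u ∈ G.nodes ∧ v ∈ G.suc u

/-- `v` is reachable from `u` in `G`. -/
def Reach (G : PreGraph L) : ℕ → ℕ → Prop := Relation.ReflTransGen (Edge G)

/-- `ReachesP G u p v`: starting in `u` and following the position `p`
(a sequence of argument indices) one reaches the node `v`. -/
inductive ReachesP (G : PreGraph L) : ℕ → List ℕ → ℕ → Prop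
  | nil (u : ℕ) : ReachesP G u [] u
  | cons {u v w : ℕ} {i : ℕ} {p : List ℕ} :
      u ∈ G.nodes → (G.suc u)[i]? = some v → ReachesP G v p w →
      ReachesP G u (i :: p) w

/-- `p` is a position of the node `u` in `G`, i.e. `p ∈ Pos_G(u)`. -/
def IsPos (G : PreGraph L) (u : ℕ) (p : List ℕ) : Prop := ReachesP G G.root p u

/-- A node is unshared if its set of positions is a singleton. -/
def Unshared (G : PreGraph L) (u : ℕ) : Prop := ∃! p, IsPos G u p

/-- A node `u` is strictly below the position `p` if `p` is a proper prefix of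
some position of `u`. -/
def StrictlyBelow (G : PreGraph L) (p : List ℕ) (u : ℕ) : Prop :=
  ∃ q, IsPos G u q ∧ p <+: q ∧ p ≠ q

open Classical in
/-- `S↾u`, the subgraph of `S` reachable from the node `u`. -/
noncomputable def subgraph (G : PreGraph L) (u : ℕ) : PreGraph L where
  nodes := G.nodes.filter fun v => Reach G u v
  suc := G.suc
  lab := G.lab
  root := u

/-- The union `G ∪ H` of two graphs (for properly sharing graphs this
is symmetric on the common nodes). -/
def gUnion (G H : PreGraph L) : PreGraph L where
  nodes := G.nodes ∪ H.nodes
  suc := fun u => if u ∈ G.nodes then G.suc u else H.suc u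
  lab := fun u => if u ∈ G.nodes then G.lab u else H.lab u
  root := G.root

/-- Two graphs are properly sharing if every common node carries the same
label and the same successor sequence in both. -/
def ProperlySharing (G H : PreGraph L) : Prop :=
  ∀ u, u ∈ G.nodes → u ∈ H.nodes → G.lab u = H.lab u ∧ G.suc u = H.suc u

/-- The redirection `G[u ≫ v]`: the node `u` is removed (and `v` added), and
`u` is replaced by `v` in all successor sequences. -/
def redirect (G : PreGraph L) (u v : ℕ) : PreGraph L where
  nodes := insert v (G.nodes.erase u)
  suc := fun w => (G.suc w).map fun x => if x = u then v else x
  lab := G.lab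
  root := if G.root = u then v else G.root

/-- The replacement `G[u ← H]`: the subgraph of `G[u ≫ root(H)] ∪ H` reachable
from `root(H)` if `u = root(G)`, and from `root(G)` otherwise. -/
noncomputable def replaceAt (G : PreGraph L) (u : ℕ) (H : PreGraph L) : PreGraph L :=
  subgraph (gUnion H (redirect G u H.root)) (if u = G.root then H.root else G.root)

/-- A term graph over the signature `F` (with arities `ar`) and variables `V`:
an acyclic rooted graph whose nodes are labelled by function symbols or
variables, such that a node labelled by `f` has `ar f` successors, a node
labelled by a variable has no successors, and variable nodes are shared. -/
structure IsTermGraph (ar : F → ℕ) (G : PreGraph (F ⊕ V)) : Prop where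
  closed : ∀ u ∈ G.nodes, ∀ v ∈ G.suc u, v ∈ G.nodes
  acyclic : ∀ u v : ℕ, Relation.TransGen (Edge G) u v → u ≠ v
  rootMem : G.root ∈ G.nodes
  rootReach : ∀ u ∈ G.nodes, Reach G G.root u
  funArity : ∀ u ∈ G.nodes, ∀ f : F, G.lab u = Sum.inl f → (G.suc u).length = ar f
  varSuc : ∀ u ∈ G.nodes, ∀ x : V, G.lab u = Sum.inr x → G.suc u = []
  varShared : ∀ u ∈ G.nodes, ∀ v ∈ G.nodes, ∀ x : V,
      G.lab u = Sum.inr x → G.lab v = Sum.inr x → u = v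

/-- Fuelled computation of the term represented by (the subgraph at) a node.
For a term graph, any fuel strictly exceeding the length of the longest
path suffices; acyclicity bounds path lengths by the number of nodes. -/
noncomputable def termAt [Inhabited V] (G : PreGraph (F ⊕ V)) : ℕ → ℕ → Tm F V
  | 0, _ => Tm.var default
  | fuel + 1, u =>
    match G.lab u with
    | Sum.inr x => Tm.var x
    | Sum.inl f => Tm.app f ((G.suc u).map fun v => termAt G fuel v)

/-- `term(G)`, the term represented by the term graph `G`. -/
noncomputable def termOf [Inhabited V] (G : PreGraph (F ⊕ V)) : Tm F V :=
  termAt G (G.nodes.card + 1) G.root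

/-- Application of a substitution `σ : V → Tm F V` to a term. -/
def substTm (σ : V → Tm F V) : Tm F V → Tm F V
  | Tm.var x => σ x
  | Tm.app f ts => Tm.app f (ts.attach.map fun t => substTm σ t.1)
decreasing_by
  have := List.sizeOf_lt_of_mem t.2
  simp only [Tm.app.sizeOf_spec]
  omega

/-- The variable `x` occurs in the term `t`. -/
inductive OccursIn (x : V) : Tm F V → Prop
  | var : OccursIn x (Tm.var x)
  | app {f : F} {ts : List (Tm F V)} {t : Tm F V} :
      t ∈ ts → OccursIn x t → OccursIn x (Tm.app f ts)

/-- A morphism `m : L → S` of term graphs: it maps nodes to nodes, root to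
root, and preserves labels and successor sequences at every node of `L`
labelled by a function symbol. -/
structure IsMorphism (L S : PreGraph (F ⊕ V)) (m : ℕ → ℕ) : Prop where
  maps : ∀ u ∈ L.nodes, m u ∈ S.nodes
  root : m L.root = S.root
  lab : ∀ u ∈ L.nodes, ∀ f : F, L.lab u = Sum.inl f → S.lab (m u) = Sum.inl f
  suc : ∀ u ∈ L.nodes, ∀ f : F, L.lab u = Sum.inl f → S.suc (m u) = (L.suc u).map m

/-- `S ≥_m T`: `m` is a morphism whose label and successor conditions hold at
*all* nodes of `S`, including variable nodes. -/
structure IsGeMorph (S T : PreGraph (F ⊕ V)) (m : ℕ → ℕ) : Prop where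
  maps : ∀ u ∈ S.nodes, m u ∈ T.nodes
  root : m S.root = T.root
  lab : ∀ u ∈ S.nodes, T.lab (m u) = S.lab u
  suc : ∀ u ∈ S.nodes, T.suc (m u) = (S.suc u).map m

open Classical in
/-- The substitution `σ_m` induced by a morphism `m : L → S`: a variable `x`
labelling the (unique) node `u` of `L` is mapped to `term(S↾m(u))`. -/
noncomputable def inducedSubst [Inhabited V] (L S : PreGraph (F ⊕ V)) (m : ℕ → ℕ) :
    V → Tm F V := fun x =>
  if h : ∃ u, u ∈ L.nodes ∧ L.lab u = Sum.inr x then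
    termOf (subgraph S (m h.choose))
  else Tm.var x

/-- `S ⊒_{u,v} T` (for nodes `u ≽ v` of `S`, taking `≻` to be the usual order
on `ℕ`): `S ≥_m T` for the morphism `m` with `m u = v` and `m w = w` for all
other nodes `w`. -/
def Collapse (S T : PreGraph (F ⊕ V)) (u v : ℕ) : Prop :=
  u ∈ S.nodes ∧ v ∈ S.nodes ∧ v ≤ u ∧
    IsGeMorph S T (fun w => if w = u then v else w)

/-- `S ⊐_{u,v} T`: `S ⊒_{u,v} T` with `u ≠ v`. -/
def CollapseS (S T : PreGraph (F ⊕ V)) (u v : ℕ) : Prop :=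
  Collapse S T u v ∧ u ≠ v

/-- The single-step folding relation `S ⊐ T`. -/
def Fold (S T : PreGraph (F ⊕ V)) : Prop := ∃ u v, CollapseS S T u v

/-- `S ⊐_p T`: `S` folds strictly below the position `p` to `T`. -/
def FoldBelow (p : List ℕ) (S T : PreGraph (F ⊕ V)) : Prop :=
  ∃ u v, CollapseS S T u v ∧ StrictlyBelow S p u ∧ StrictlyBelow S p v

/-- `S ▷_p T`: `S` unfolds above the position `p` to `T`, i.e. `T ⊐_{u,v} S`
for some node `u` of `T` that is unshared in `T` and whose unique position is
a prefix of `p`. -/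
def UnfoldAbove (p : List ℕ) (S T : PreGraph (F ⊕ V)) : Prop :=
  ∃ u v, CollapseS T S u v ∧ ∃ q, q <+: p ∧ (∀ q', IsPos T u q' ↔ q' = q)

/-- The relation `⊐` restricted to term graphs. -/
def FoldTG (ar : F → ℕ) (S T : PreGraph (F ⊕ V)) : Prop :=
  IsTermGraph ar S ∧ IsTermGraph ar T ∧ Fold S T

/-- The relation `⊐_p` restricted to term graphs. -/
def FoldBelowTG (ar : F → ℕ) (p : List ℕ) (S T : PreGraph (F ⊕ V)) : Prop :=
  IsTermGraph ar S ∧ IsTermGraph ar T ∧ FoldBelow p S T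

/-- The relation `▷_p` restricted to term graphs. -/
def UnfoldAboveTG (ar : F → ℕ) (p : List ℕ) (S T : PreGraph (F ⊕ V)) : Prop :=
  IsTermGraph ar S ∧ IsTermGraph ar T ∧ UnfoldAbove p S T

/-- `a →^! b` for an abstract relation `r`: `a r^* b` and `b` is `r`-minimal. -/
def NormTo {α : Type _} (r : α → α → Prop) (a b : α) : Prop :=
  Relation.ReflTransGen r a b ∧ ∀ c, ¬ r b c

/-- The `n`-fold composition of an abstract relation. -/
def Iter {α : Type _} (r : α → α → Prop) : ℕ → α → α → Prop
  | 0 => Eq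
  | n + 1 => fun a c => ∃ b, r a b ∧ Iter r n b c

/-- The node `u` of `G` is labelled by a variable. -/
def IsVarNode (G : PreGraph (F ⊕ V)) (u : ℕ) : Prop := ∃ x : V, G.lab u = Sum.inr x

/-- A graph rewrite rule `L → R`: `L` and `R` are properly sharing term
graphs, `root(L)` is not a variable node, every variable of `R` occurs in
`L`, and `root(L)` is not a node of `R`. -/
structure IsRule (ar : F → ℕ) (Lhs Rhs : PreGraph (F ⊕ V)) : Prop where
  lhs : IsTermGraph ar Lhs
  rhs : IsTermGraph ar Rhs
  sharing : ProperlySharing Lhs Rhs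
  rootNotVar : ¬ IsVarNode Lhs Lhs.root
  varsSub : ∀ x : V, (∃ u ∈ Rhs.nodes, Rhs.lab u = Sum.inr x) →
      (∃ u ∈ Lhs.nodes, Lhs.lab u = Sum.inr x)
  rootNotInRhs : Lhs.root ∉ Rhs.nodes

/-- `m(R)`: the graph obtained from `R` by replacing every node `v` in the
domain `dom` of the morphism `m` by `m v`; the replaced nodes keep the labels
and successor sequences they have in `S`. -/
def applyMorph (dom : Finset ℕ) (m : ℕ → ℕ) (S R : PreGraph (F ⊕ V)) :
    PreGraph (F ⊕ V) where
  nodes := R.nodes.image fun v => if v ∈ dom then m v else v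
  suc := fun w => if w ∈ S.nodes then S.suc w
                  else (R.suc w).map fun x => if x ∈ dom then m x else x
  lab := fun w => if w ∈ S.nodes then S.lab w else R.lab w
  root := if R.root ∈ dom then m R.root else R.root

/-- `φ` exhibits `G'` as an isomorphic copy of `G`. -/
structure GIsoOn (φ : ℕ → ℕ) (G G' : PreGraph (F ⊕ V)) : Prop where
  nodes : G'.nodes = G.nodes.image φ
  root : φ G.root = G'.root
  lab : ∀ u ∈ G.nodes, G'.lab (φ u) = G.lab u
  suc : ∀ u ∈ G.nodes, G'.suc (φ u) = (G.suc u).map φ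

/-- `L' → R'` is a renaming of the rule `L → R` with respect to `S`: an
isomorphic copy that is node-disjoint from `S`. -/
def IsRenaming (L R L' R' S : PreGraph (F ⊕ V)) : Prop :=
  ∃ φ : ℕ → ℕ, Set.InjOn φ ↑(L.nodes ∪ R.nodes) ∧
    GIsoOn φ L L' ∧ GIsoOn φ R R' ∧ Disjoint (L'.nodes ∪ R'.nodes) S.nodes

/-- `S ⇒_{G,u} T`: a graph rewrite step at the node `u`, using a renaming
`L' → R'` of some rule of `G`, a morphism `m : L' → S↾u`, and
`T = S[u ← m(R')]`. -/
def GStepAt (G : Set (PreGraph (F ⊕ V) × PreGraph (F ⊕ V))) (u : ℕ)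
    (S T : PreGraph (F ⊕ V)) : Prop :=
  ∃ LR ∈ G, ∃ L' R' : PreGraph (F ⊕ V), ∃ m : ℕ → ℕ,
    IsRenaming LR.1 LR.2 L' R' S ∧
    IsMorphism L' (subgraph S u) m ∧
    T = replaceAt S u (applyMorph L'.nodes m S R')

/-- `S ⇒_{G,p} T`: a graph rewrite step at the node corresponding to the
position `p`. -/
def GStepP (G : Set (PreGraph (F ⊕ V) × PreGraph (F ⊕ V))) (p : List ℕ)
    (S T : PreGraph (F ⊕ V)) : Prop :=
  ∃ u, IsPos S u p ∧ GStepAt G u S T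

/-- A term rewrite system: a finite set of rules `l → r` where `l` is not a
variable and every variable of `r` occurs in `l`. -/
def IsTRS (R : Set (Tm F V × Tm F V)) : Prop :=
  R.Finite ∧ ∀ lr ∈ R, (∀ x : V, lr.1 ≠ Tm.var x) ∧
    ∀ x : V, OccursIn x lr.2 → OccursIn x lr.1

/-- `s →_{R,p} t`: a rewrite step of the TRS `R` at position `p`. -/
inductive RewriteAt (R : Set (Tm F V × Tm F V)) : List ℕ → Tm F V → Tm F V → Prop
  | root {l r : Tm F V} (σ : V → Tm F V) :
      (l, r) ∈ R → RewriteAt R [] (substTm σ l) (substTm σ r)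
  | congr {i : ℕ} {p : List ℕ} {f : F} {ts : List (Tm F V)} {t t' : Tm F V} :
      ts[i]? = some t → RewriteAt R p t t' →
      RewriteAt R (i :: p) (Tm.app f ts) (Tm.app f (ts.set i t'))

/-- A graph is minimally sharing if every node is a variable node or unshared. -/
def MinimallySharing (G : PreGraph (F ⊕ V)) : Prop :=
  ∀ u ∈ G.nodes, IsVarNode G u ∨ Unshared G u

/-- A graph is maximally sharing if distinct nodes represent distinct terms. -/
def MaximallySharing [Inhabited V] (G : PreGraph (F ⊕ V)) : Prop :=
  ∀ u ∈ G.nodes, ∀ v ∈ G.nodes,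
    termOf (subgraph G u) = termOf (subgraph G v) → u = v

/-- `G ∈ Tree(s)`: `G` is a minimally sharing term graph representing `s`. -/
def InTree [Inhabited V] (ar : F → ℕ) (s : Tm F V) (G : PreGraph (F ⊕ V)) : Prop :=
  IsTermGraph ar G ∧ MinimallySharing G ∧ termOf G = s

/-- `G ∈ Shared(s)`: `G` is a maximally sharing term graph representing `s`. -/
def InShared [Inhabited V] (ar : F → ℕ) (s : Tm F V) (G : PreGraph (F ⊕ V)) : Prop :=
  IsTermGraph ar G ∧ MaximallySharing G ∧ termOf G = s

/-- `L → R` is a graph rewrite rule simulating the term rewrite rule `l → r`: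
`L ∈ Tree(l)`, `R ∈ Tree(r)` and the common nodes of `L` and `R` are exactly
the variable nodes of `R`. -/
def SimRule [Inhabited V] (ar : F → ℕ) (l r : Tm F V)
    (Lg Rg : PreGraph (F ⊕ V)) : Prop :=
  IsRule ar Lg Rg ∧ InTree ar l Lg ∧ InTree ar r Rg ∧
    ∀ w : ℕ, (w ∈ Lg.nodes ∧ w ∈ Rg.nodes) ↔ (w ∈ Rg.nodes ∧ IsVarNode Rg w)

/-- `G` is the simulating graph rewrite system `G(R)` of the TRS `R`. -/
def IsSimGRS [Inhabited V] (ar : F → ℕ) (R : Set (Tm F V × Tm F V))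
    (G : Set (PreGraph (F ⊕ V) × PreGraph (F ⊕ V))) : Prop :=
  (∀ lr ∈ R, ∃ LR ∈ G, SimRule ar lr.1 lr.2 LR.1 LR.2) ∧
  (∀ LR ∈ G, ∃ lr ∈ R, SimRule ar lr.1 lr.2 LR.1 LR.2)

/-- `S ⇒ˢ_{G,p} T`: `S ▷_p^! U`, `U ⊐_p^! V` and `V ⇒_{G,p} T` for some
term graphs `U`, `V`. -/
def SStepP (ar : F → ℕ) (G : Set (PreGraph (F ⊕ V) × PreGraph (F ⊕ V)))
    (p : List ℕ) (S T : PreGraph (F ⊕ V)) : Prop :=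
  ∃ U Vg : PreGraph (F ⊕ V),
    NormTo (UnfoldAboveTG ar p) S U ∧ NormTo (FoldBelowTG ar p) U Vg ∧
    GStepP G p Vg T

/-- `S ⇒ˢ_G T`: an `⇒ˢ`-step at some position. -/
def SStep (ar : F → ℕ) (G : Set (PreGraph (F ⊕ V) × PreGraph (F ⊕ V)))
    (S T : PreGraph (F ⊕ V)) : Prop :=
  ∃ p : List ℕ, SStepP ar G p S T

/-- `G` has a path of `n` edges. -/
def HasPathLen (G : PreGraph L) (n : ℕ) : Prop :=
  ∃ l : List ℕ, l.length = n + 1 ∧ l.Chain' (Edge G) ∧ ∀ x ∈ l, x ∈ G.nodes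

/-- The depth of `G`: the length of the longest path in `G`. -/
noncomputable def depth (G : PreGraph L) : ℕ := sSup {n | HasPathLen G n}

/-- Filling every hole of a context (a term over `F ∪ {□}`, the hole `□`
being represented by `none`) with the term `t`. -/
def fillAll (t : Tm F V) : Tm (Option F) V → Tm F V
  | Tm.var x => Tm.var x
  | Tm.app none _ => t
  | Tm.app (some f) ts => Tm.app f (ts.attach.map fun c => fillAll t c.1)
decreasing_by
  have := List.sizeOf_lt_of_mem c.2
  simp only [Tm.app.sizeOf_spec]
  omega

/-- Viewing a graph over `F ∪ V` as a graph over `(F ∪ {□}) ∪ V`. -/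
def relabel (G : PreGraph (F ⊕ V)) : PreGraph (Option F ⊕ V) where
  nodes := G.nodes
  suc := G.suc
  lab := fun u => Sum.map some id (G.lab u)
  root := G.root

/-- The one-node graph consisting of a hole node `h` labelled `□`. -/
def holeGraph (h : ℕ) : PreGraph (Option F ⊕ V) where
  nodes := {h}
  suc := fun _ => []
  lab := fun _ => Sum.inl none
  root := h

/-- The number of nodes of the subgraph at a successor is strictly smaller. -/
theorem card_subgraph_lt_of_mem_suc {G : PreGraph L}
    (acyclic : ∀ u v : ℕ, Relation.TransGen (Edge G) u v → u ≠ v)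
    {u v : ℕ} (hu : u ∈ G.nodes) (hv : v ∈ G.suc u) :
    (subgraph G v).nodes.card < (subgraph G u).nodes.card := by
  classical
  apply Finset.card_lt_card
  have huv : Edge G u v := ⟨hu, hv⟩
  refine (Finset.ssubset_iff_of_subset ?_).2 ⟨u, ?_, ?_⟩
  · intro w hw
    simp only [subgraph, Finset.mem_filter] at hw ⊢
    exact ⟨hw.1, Relation.ReflTransGen.head huv hw.2⟩
  · simp only [subgraph, Finset.mem_filter]
    exact ⟨hu, Relation.ReflTransGen.refl⟩
  · simp only [subgraph, Finset.mem_filter]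
    rintro ⟨-, h⟩
    exact acyclic u u (Relation.TransGen.head' huv h) rfl

theorem card_subgraph_pos {G : PreGraph L} {u : ℕ} (hu : u ∈ G.nodes) :
    0 < (subgraph G u).nodes.card := by
  refine Finset.card_pos.2 ⟨u, ?_⟩
  simp only [subgraph, Finset.mem_filter]
  exact ⟨hu, Relation.ReflTransGen.refl⟩

theorem card_subgraph_le (G : PreGraph L) (u : ℕ) :
    (subgraph G u).nodes.card ≤ G.nodes.card := by
  classical exact Finset.card_le_card (Finset.filter_subset _ _)

theorem termAt_subgraph [Inhabited V] (G : PreGraph (F ⊕ V)) (w n u : ℕ) :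
    termAt (subgraph G w) n u = termAt G n u := by
  induction n generalizing u with
  | zero => rfl
  | succ n ih => simp [termAt, subgraph, ← ih]

/-- Any two amounts of fuel bounding the size of the subgraph at `u` give the same term. -/
theorem termAt_eq_termAt [Inhabited V] {ar : F → ℕ} {G : PreGraph (F ⊕ V)}
    (hG : IsTermGraph ar G) {n k u : ℕ} (hu : u ∈ G.nodes)
    (hn : (subgraph G u).nodes.card ≤ n) (hk : (subgraph G u).nodes.card ≤ k) :
    termAt G n u = termAt G k u := by
  have hpos := card_subgraph_pos hu
  induction n generalizing k u with
  | zero => omega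
  | succ n ih =>
    obtain ⟨k, rfl⟩ := Nat.exists_eq_add_one_of_ne_zero (show k ≠ 0 by omega)
    cases hlab : G.lab u with
    | inr x => simp only [termAt, hlab]
    | inl f =>
      simp only [termAt, hlab, Tm.app.injEq, true_and]
      refine List.map_congr_left fun v hv => ?_
      have hlt := card_subgraph_lt_of_mem_suc hG.acyclic hu hv
      have hvG := hG.closed u hu v hv
      exact ih hvG (by omega) (by omega) (card_subgraph_pos hvG)

theorem inducedSubst_eq [Inhabited V] {ar : F → ℕ} {G : PreGraph (F ⊕ V)}
    (hG : IsTermGraph ar G) (S : PreGraph (F ⊕ V)) (m : ℕ → ℕ) {u : ℕ} {x : V}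
    (hu : u ∈ G.nodes) (hx : G.lab u = Sum.inr x) :
    inducedSubst G S m x = termOf (subgraph S (m u)) := by
  have h : ∃ u, u ∈ G.nodes ∧ G.lab u = Sum.inr x := ⟨u, hu, hx⟩
  rw [inducedSubst, dif_pos h,
    hG.varShared _ h.choose_spec.1 u hu x h.choose_spec.2 hx]

/-- The induced substitution maps the term at a node `u` to the term at its image `m u`. -/
theorem substTm_termAt [Inhabited V] {ar : F → ℕ} {G S : PreGraph (F ⊕ V)}
    (hG : IsTermGraph ar G) (hS : IsTermGraph ar S) {m : ℕ → ℕ}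
    (hm : IsMorphism G S m) {n k u : ℕ} (hu : u ∈ G.nodes)
    (hn : (subgraph G u).nodes.card ≤ n) (hk : (subgraph S (m u)).nodes.card ≤ k) :
    substTm (inducedSubst G S m) (termAt G n u) = termAt S k (m u) := by
  have hposG := card_subgraph_pos hu
  have hmu := hm.maps u hu
  have hposS := card_subgraph_pos hmu
  induction n generalizing k u with
  | zero => omega
  | succ n ih =>
    cases hlab : G.lab u with
    | inr x =>
      simp only [termAt, hlab, substTm]
      rw [inducedSubst_eq hG S m hu hlab, termOf, termAt_subgraph]
      exact termAt_eq_termAt hS hmu (Nat.le_succ _) hk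
    | inl f =>
      obtain ⟨k, rfl⟩ := Nat.exists_eq_add_one_of_ne_zero (show k ≠ 0 by omega)
      simp only [termAt, hlab, hm.lab u hu f hlab, hm.suc u hu f hlab, substTm,
        List.map_attach_eq_pmap, List.pmap_eq_map, List.map_map, Tm.app.injEq, true_and]
      refine List.map_congr_left fun v hv => ?_
      have hvG := hG.closed u hu v hv
      have hmv : m v ∈ S.suc (m u) := by
        rw [hm.suc u hu f hlab]
        exact List.mem_map_of_mem hv
      have hltG := card_subgraph_lt_of_mem_suc hG.acyclic hu hv
      have hltS := card_subgraph_lt_of_mem_suc hS.acyclic hmu hmv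
      exact ih hvG (by omega) (by omega) (card_subgraph_pos hvG) (hm.maps v hvG)
        (card_subgraph_pos (hm.maps v hvG))

/-- If `m : L → S` is a term graph morphism and `σ_m` its induced
substitution, then `term(L)σ_m = term(S)`. -/
theorem term_lhs_induced_subst {F V : Type} [Inhabited V] (ar : F → ℕ)
    (L S : PreGraph (F ⊕ V)) (hL : IsTermGraph ar L) (hS : IsTermGraph ar S)
    (m : ℕ → ℕ) (hm : IsMorphism L S m) :
    substTm (inducedSubst L S m) (termOf L) = termOf S := by
  rw [termOf, termOf, ← hm.root]
  exact substTm_termAt hL hS hm hL.rootMem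
    ((card_subgraph_le _ _).trans (Nat.le_succ _))
    ((card_subgraph_le _ _).trans (Nat.le_succ _))

end TermGraphs
end

section
/- Let l be a term and s = lσ for a substitution σ. If L ∈ Tree(l) and S ∈ Shared(s), then there exists a morphism m : L → S, and moreover σ(x) = σ_m(x) for the induced substitution σ_m and all variables x occurring in l. -/
namespace TermGraphs

variable {F V L : Type}

theorem substTm_app (σ : V → Tm F V) (f : F) (ts : List (Tm F V)) :
    substTm σ (Tm.app f ts) = Tm.app f (ts.map (substTm σ)) := by
  rw [substTm]
  congr 1
  exact List.attach_map_val (f := substTm σ)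

/-- The number of nodes properly below a node. -/
noncomputable def rank (G : PreGraph L) (u : ℕ) : ℕ :=
  {v ∈ (G.nodes : Set ℕ) | Relation.TransGen (Edge G) u v}.ncard

theorem rank_lt_of_edge {ar : F → ℕ} {G : PreGraph (F ⊕ V)} (hG : IsTermGraph ar G)
    {u v : ℕ} (h : Edge G u v) : rank G v < rank G u := by
  refine Set.ncard_lt_ncard ?_ (G.nodes.finite_toSet.subset fun w hw => hw.1)
  refine ⟨fun w hw => ⟨hw.1, .head h hw.2⟩, fun hsub => ?_⟩
  have hv : v ∈ {w ∈ (G.nodes : Set ℕ) | Relation.TransGen (Edge G) v w} :=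
    hsub ⟨hG.closed u h.1 v h.2, .single h⟩
  exact hG.acyclic v v hv.2 rfl

theorem mem_nodes_subgraph {G : PreGraph L} {u v : ℕ} :
    v ∈ (subgraph G u).nodes ↔ v ∈ G.nodes ∧ Reach G u v := by
  simp [subgraph]

theorem rank_le_card_subgraph (G : PreGraph L) (u : ℕ) :
    rank G u ≤ (subgraph G u).nodes.card := by
  rw [← Set.ncard_coe_finset]
  refine Set.ncard_le_ncard (fun w hw => ?_) (Finset.finite_toSet _)
  exact Finset.mem_coe.2 (mem_nodes_subgraph.2 ⟨hw.1, hw.2.to_reflTransGen⟩)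

/-- Any fuel exceeding the rank of a node computes the same term. -/
theorem termAt_eq_of_rank_lt [Inhabited V] {ar : F → ℕ} {G : PreGraph (F ⊕ V)}
    (hG : IsTermGraph ar G) {n k u : ℕ} (hu : u ∈ G.nodes) (hn : rank G u < n)
    (hk : rank G u < k) : termAt G n u = termAt G k u := by
  induction n generalizing k u with
  | zero => omega
  | succ n ih =>
    obtain _ | k := k
    · omega
    rw [termAt, termAt]
    cases G.lab u with
    | inr x => rfl
    | inl f =>
      refine congrArg (Tm.app f) (List.map_congr_left fun v hv => ?_)
      have hlt := rank_lt_of_edge hG ⟨hu, hv⟩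
      exact ih (hG.closed u hu v hv) (by omega) (by omega)

/-- The term represented by a node of a graph. -/
noncomputable def nodeTerm [Inhabited V] (G : PreGraph (F ⊕ V)) (u : ℕ) : Tm F V :=
  termOf (subgraph G u)

section nodeTerm

variable [Inhabited V] {ar : F → ℕ} {G : PreGraph (F ⊕ V)} {u : ℕ}

theorem nodeTerm_eq_termAt (hG : IsTermGraph ar G) {n : ℕ} (hu : u ∈ G.nodes)
    (hn : rank G u < n) : nodeTerm G u = termAt G n u := by
  rw [nodeTerm, termOf, termAt_subgraph]
  exact termAt_eq_of_rank_lt hG hu (Nat.lt_succ_of_le (rank_le_card_subgraph G u)) hn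

theorem nodeTerm_root (hG : IsTermGraph ar G) : nodeTerm G G.root = termOf G :=
  nodeTerm_eq_termAt hG hG.rootMem
    (Nat.lt_succ_of_le ((rank_le_card_subgraph G _).trans (card_subgraph_le G _)))

theorem nodeTerm_of_lab_inr (hG : IsTermGraph ar G) (hu : u ∈ G.nodes) {x : V}
    (hx : G.lab u = Sum.inr x) : nodeTerm G u = Tm.var x := by
  rw [nodeTerm_eq_termAt hG hu (Nat.lt_succ_self _), termAt, hx]

theorem nodeTerm_of_lab_inl (hG : IsTermGraph ar G) (hu : u ∈ G.nodes) {f : F}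
    (hf : G.lab u = Sum.inl f) :
    nodeTerm G u = Tm.app f ((G.suc u).map (nodeTerm G)) := by
  rw [nodeTerm_eq_termAt hG hu (Nat.lt_succ_self _), termAt, hf]
  refine congrArg (Tm.app f) (List.map_congr_left fun v hv => ?_)
  exact (nodeTerm_eq_termAt hG (hG.closed u hu v hv) (rank_lt_of_edge hG ⟨hu, hv⟩)).symm

/-- A node representing a compound term is labelled by its head symbol. -/
theorem lab_and_suc_of_nodeTerm_eq_app (hG : IsTermGraph ar G) (hu : u ∈ G.nodes) {f : F}
    {ts : List (Tm F V)} (h : nodeTerm G u = Tm.app f ts) :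
    G.lab u = Sum.inl f ∧ (G.suc u).map (nodeTerm G) = ts := by
  cases hl : G.lab u with
  | inr x => simp [nodeTerm_of_lab_inr hG hu hl] at h
  | inl g =>
    rw [nodeTerm_of_lab_inl hG hu hl] at h
    injection h with h₁ h₂
    exact ⟨by rw [h₁], h₂⟩

theorem exists_node_of_occursIn (hG : IsTermGraph ar G) {x : V} {t : Tm F V}
    (hx : OccursIn x t) (hu : u ∈ G.nodes) (ht : nodeTerm G u = t) :
    ∃ v, v ∈ G.nodes ∧ G.lab v = Sum.inr x := by
  induction hx generalizing u with
  | var =>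
    cases hl : G.lab u with
    | inl f => simp [nodeTerm_of_lab_inl hG hu hl] at ht
    | inr y =>
      rw [nodeTerm_of_lab_inr hG hu hl] at ht
      injection ht with hy
      exact ⟨u, hu, by rw [hl, hy]⟩
  | app hmem _ ih =>
    obtain ⟨-, rfl⟩ := lab_and_suc_of_nodeTerm_eq_app hG hu ht
    obtain ⟨v, hv, hvt⟩ := List.mem_map.1 hmem
    exact ih (hG.closed u hu v hv) hvt

end nodeTerm

/-- Every node of a graph for `l` has a counterpart in any graph for `lσ`. -/
theorem exists_node_nodeTerm_eq_substTm [Inhabited V] {ar : F → ℕ} {σ : V → Tm F V}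
    {G H : PreGraph (F ⊕ V)} (hG : IsTermGraph ar G) (hH : IsTermGraph ar H)
    (h : termOf H = substTm σ (termOf G)) {u : ℕ} (hu : u ∈ G.nodes) :
    ∃ v ∈ H.nodes, nodeTerm H v = substTm σ (nodeTerm G u) := by
  induction hG.rootReach u hu with
  | refl => exact ⟨H.root, hH.rootMem, by rw [nodeTerm_root hH, nodeTerm_root hG, h]⟩
  | @tail a b _ hab ih =>
    obtain ⟨v, hv, hvt⟩ := ih hab.1
    cases hl : G.lab a with
    | inr x => simp [Edge, hG.varSuc a hab.1 x hl] at hab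
    | inl f =>
      rw [nodeTerm_of_lab_inl hG hab.1 hl, substTm_app] at hvt
      have hsuc := (lab_and_suc_of_nodeTerm_eq_app hH hv hvt).2
      have hb : substTm σ (nodeTerm G b) ∈ (H.suc v).map (nodeTerm H) := by
        rw [hsuc]
        exact List.mem_map_of_mem (List.mem_map_of_mem hab.2)
      obtain ⟨w, hw, hwt⟩ := List.mem_map.1 hb
      exact ⟨w, hH.closed v hv w hw, hwt⟩

theorem list_eq_of_map_eq_of_injOn {α β : Type} {g : α → β} {s : Set α} (hg : Set.InjOn g s)
    {l₁ l₂ : List α} (h₁ : ∀ a ∈ l₁, a ∈ s) (h₂ : ∀ a ∈ l₂, a ∈ s)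
    (h : l₁.map g = l₂.map g) : l₁ = l₂ := by
  induction l₁ generalizing l₂ with
  | nil => simpa [eq_comm] using h
  | cons a l₁ ih =>
    obtain _ | ⟨b, l₂⟩ := l₂
    · simp at h
    · simp only [List.map_cons, List.cons.injEq, List.forall_mem_cons] at h h₁ h₂
      rw [hg h₁.1 h₂.1 h.1, ih h₁.2 h₂.2 h.2]

/-- If `s = lσ`, `L ∈ Tree(l)` and `S ∈ Shared(s)`, then there is
a morphism `m : L → S`, and `σ(x) = σ_m(x)` for all variables `x` occurring
in `l`. -/
theorem tree_matches_shared {F V : Type} [Inhabited V] (ar : F → ℕ)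
    (l : Tm F V) (σ : V → Tm F V) (s : Tm F V) (hs : s = substTm σ l)
    (Lg S : PreGraph (F ⊕ V)) (hL : InTree ar l Lg) (hS : InShared ar s S) :
    ∃ m : ℕ → ℕ, IsMorphism Lg S m ∧
      ∀ x : V, OccursIn x l → σ x = inducedSubst Lg S m x := by
  obtain ⟨hLg, -, rfl⟩ := hL
  obtain ⟨hSg, hmax, hterm⟩ := hS
  have hex : ∀ u, ∃ v, u ∈ Lg.nodes →
      v ∈ S.nodes ∧ nodeTerm S v = substTm σ (nodeTerm Lg u) := fun u => by
    by_cases hu : u ∈ Lg.nodes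
    · obtain ⟨v, hv⟩ := exists_node_nodeTerm_eq_substTm hLg hSg (hterm.trans hs) hu
      exact ⟨v, fun _ => hv⟩
    · exact ⟨0, fun h => absurd h hu⟩
  choose m hm using hex
  have hmorph : ∀ u ∈ Lg.nodes, ∀ f : F, Lg.lab u = Sum.inl f →
      S.lab (m u) = Sum.inl f ∧ S.suc (m u) = (Lg.suc u).map m := fun u hu f hf => by
    obtain ⟨hmu, ht⟩ := hm u hu
    rw [nodeTerm_of_lab_inl hLg hu hf, substTm_app] at ht
    obtain ⟨hlab, hsuc⟩ := lab_and_suc_of_nodeTerm_eq_app hSg hmu ht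
    have hsucm : ∀ v ∈ Lg.suc u, m v ∈ S.nodes ∧ _ := fun v hv => hm v (hLg.closed u hu v hv)
    refine ⟨hlab, list_eq_of_map_eq_of_injOn (g := nodeTerm S) (s := S.nodes)
      (fun a ha b hb => hmax a ha b hb) (hSg.closed _ hmu) ?_ ?_⟩
    · simpa using fun v hv => (hsucm v hv).1
    · rw [hsuc, List.map_map, List.map_map]
      exact List.map_congr_left fun v hv => (hsucm v hv).2.symm
  refine ⟨m, ⟨fun u hu => (hm u hu).1, ?_, fun u hu f hf => (hmorph u hu f hf).1,
    fun u hu f hf => (hmorph u hu f hf).2⟩, fun x hx => ?_⟩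
  · obtain ⟨hr, ht⟩ := hm Lg.root hLg.rootMem
    refine hmax _ hr _ hSg.rootMem (ht.trans ?_)
    rw [nodeTerm_root hLg, ← hs, ← hterm]
    exact (nodeTerm_root hSg).symm
  · have h := exists_node_of_occursIn hLg hx hLg.rootMem (nodeTerm_root hLg)
    have ht := (hm _ h.choose_spec.1).2
    rw [nodeTerm_of_lab_inr hLg h.choose_spec.1 h.choose_spec.2, substTm] at ht
    rw [inducedSubst, dif_pos h, ← ht, nodeTerm]

end TermGraphs
end

section
/- The single-step folding approximations satisfy the following diamond property: if S ⊒_{u',u} T₁ and S ⊒_{v',v} T₂ for term graphs S, T₁, T₂, then there exist a term graph U and nodes w₁, w₂ ∈ {u, v} such that T₁ ⊒_{·,w₁} U and T₂ ⊒_{·,w₂} U (where X ⊒_{·,w} Y means X ⊒_{x,w} Y for some node x). -/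
namespace TermGraphs

variable {F V L : Type}

/-- The node map underlying `S ⊒_{u,v} T`. -/
def collapseMap (u v : ℕ) : ℕ → ℕ := fun w => if w = u then v else w

theorem collapseMap_rel {r : ℕ → ℕ → Prop} (hr : Equivalence r) {u v : ℕ} (h : r u v) (z : ℕ) :
    r z (collapseMap u v z) := by
  unfold collapseMap
  split_ifs with hz
  · exact hz ▸ h
  · exact hr.refl z

/-- In a term graph, every node is accessible for the successor relation. -/
theorem IsTermGraph.acc {F V : Type} {ar : F → ℕ} {S : PreGraph (F ⊕ V)} (hS : IsTermGraph ar S)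
    {z : ℕ} (hz : z ∈ S.nodes) : Acc (flip (Edge S)) z := by
  have : IsStrictOrder ℕ (flip (Relation.TransGen (Edge S))) :=
    { irrefl := fun a h => hS.acyclic a a h rfl
      trans := fun a b c hab hbc => Relation.TransGen.trans hbc hab }
  have hwf : (S.nodes : Set ℕ).WellFoundedOn (flip (Relation.TransGen (Edge S))) :=
    S.nodes.finite_toSet.wellFoundedOn
  refine hwf.induction (P := fun z => Acc (flip (Edge S)) z) (Finset.mem_coe.2 hz)
    fun y hy ih => Acc.intro y fun t ht => ?_
  exact ih t (Finset.mem_coe.2 (hS.closed y hy t ht.2)) (Relation.TransGen.single ht)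

theorem _root_.Acc.not_rel_self {α : Type*} {r : α → α → Prop} {a : α} (h : Acc r a) :
    ¬ r a a := by
  induction h with
  | intro a _ ih => exact fun ha => ih a ha ha

/-- Accessibility for the successor relation transfers along total morphisms. -/
theorem IsGeMorph.acc {F V : Type} {S T : PreGraph (F ⊕ V)} {m : ℕ → ℕ}
    (h : IsGeMorph S T m) (hc : ∀ u ∈ S.nodes, ∀ v ∈ S.suc u, v ∈ S.nodes) {z : ℕ}
    (ha : Acc (flip (Edge S)) z) (hz : z ∈ S.nodes) : Acc (flip (Edge T)) (m z) := by
  induction ha with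
  | intro z _ ih =>
    refine Acc.intro _ fun t ht => ?_
    have ht2 := ht.2
    rw [h.suc z hz, List.mem_map] at ht2
    obtain ⟨s, hs, rfl⟩ := ht2
    exact ih s ⟨hz, hs⟩ (hc z hz s hs)

/-- A total morphism into a rooted graph is surjective. -/
theorem IsGeMorph.surj {F V : Type} {ar : F → ℕ} {S T : PreGraph (F ⊕ V)} {m : ℕ → ℕ}
    (h : IsGeMorph S T m) (hS : IsTermGraph ar S) (hT : IsTermGraph ar T) {w : ℕ}
    (hw : w ∈ T.nodes) : ∃ z ∈ S.nodes, m z = w := by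
  induction hT.rootReach w hw with
  | refl => exact ⟨S.root, hS.rootMem, h.root⟩
  | tail _ he ih =>
    obtain ⟨z, hz, rfl⟩ := ih he.1
    have he2 := he.2
    rw [h.suc z hz, List.mem_map] at he2
    obtain ⟨s, hs, rfl⟩ := he2
    exact ⟨s, hS.closed z hz s hs, rfl⟩

/-- Total morphisms factor through each other when their node maps do. -/
theorem IsGeMorph.factor {F V : Type} {ar : F → ℕ} {S T U : PreGraph (F ⊕ V)} {m n k : ℕ → ℕ}
    (hS : IsTermGraph ar S) (hT : IsTermGraph ar T) (hm : IsGeMorph S T m)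
    (hk : IsGeMorph S U k) (hn : ∀ z, n (m z) = k z) : IsGeMorph T U n where
  maps w hw := by
    obtain ⟨z, hz, rfl⟩ := hm.surj hS hT hw
    exact hn z ▸ hk.maps z hz
  root := by rw [← hm.root, hn, hk.root]
  lab w hw := by
    obtain ⟨z, hz, rfl⟩ := hm.surj hS hT hw
    rw [hn, hk.lab z hz, hm.lab z hz]
  suc w hw := by
    obtain ⟨z, hz, rfl⟩ := hm.surj hS hT hw
    rw [hn, hk.suc z hz, hm.suc z hz, List.map_map]
    exact List.map_congr_left fun t _ => (hn t).symm

/-- The image of a graph under a map on its nodes. -/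
def imageGraph {L : Type} (S : PreGraph L) (m : ℕ → ℕ) : PreGraph L where
  nodes := S.nodes.image m
  suc := fun w => (S.suc w).map m
  lab := S.lab
  root := m S.root

theorem imageGraph_isGeMorph {F V : Type} {S : PreGraph (F ⊕ V)} {m : ℕ → ℕ}
    (hlab : ∀ z ∈ S.nodes, S.lab (m z) = S.lab z)
    (hsuc : ∀ z ∈ S.nodes, (S.suc (m z)).map m = (S.suc z).map m) :
    IsGeMorph S (imageGraph S m) m where
  maps _ hz := Finset.mem_image_of_mem m hz
  root := rfl
  lab := hlab
  suc := hsuc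

theorem imageGraph_isTermGraph {F V : Type} {ar : F → ℕ} {S : PreGraph (F ⊕ V)}
    (hS : IsTermGraph ar S) {m : ℕ → ℕ} (hmem : ∀ z ∈ S.nodes, m z ∈ S.nodes)
    (h : IsGeMorph S (imageGraph S m) m) : IsTermGraph ar (imageGraph S m) := by
  have hsub : ∀ w ∈ (imageGraph S m).nodes, w ∈ S.nodes := by
    intro w hw
    obtain ⟨z, hz, rfl⟩ := Finset.mem_image.1 hw
    exact hmem z hz
  refine ⟨?_, ?_, ?_, ?_, ?_, ?_, ?_⟩
  · intro w hw t ht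
    obtain ⟨s, hs, rfl⟩ := List.mem_map.1 ht
    exact Finset.mem_image_of_mem m (hS.closed w (hsub w hw) s hs)
  · rintro w _ hw rfl
    have hmw : w ∈ (imageGraph S m).nodes := by
      obtain ⟨t, ht, -⟩ := Relation.TransGen.head'_iff.1 hw
      exact ht.1
    obtain ⟨z, hz, rfl⟩ := Finset.mem_image.1 hmw
    have ha := (h.acc hS.closed (hS.acc hz) hz).transGen
    have hloop : Relation.TransGen (flip (Edge (imageGraph S m))) (m z) (m z) :=
      Relation.transGen_swap.2 hw
    exact ha.not_rel_self hloop
  · exact Finset.mem_image_of_mem m hS.rootMem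
  · intro w hw
    obtain ⟨z, hz, rfl⟩ := Finset.mem_image.1 hw
    refine Relation.ReflTransGen.lift m (fun a b hab => ?_) _ _ (hS.rootReach z hz)
    exact ⟨h.maps a hab.1, h.suc a hab.1 ▸ List.mem_map_of_mem hab.2⟩
  · intro w hw f hf
    exact (List.length_map m).trans (hS.funArity w (hsub w hw) f hf)
  · intro w hw x hx
    exact List.map_eq_nil_iff.2 (hS.varSuc w (hsub w hw) x hx)
  · intro w hw t ht x hx hy
    exact hS.varShared w (hsub w hw) t (hsub t ht) x hx hy

/-- The nodes `x₁, w₁, x₂, w₂` close the span given by collapsing `u'` to `u` and `v'` to `v`. -/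
structure ClosesSpan (u' u v' v x₁ w₁ x₂ w₂ : ℕ) : Prop where
  comm : ∀ z, collapseMap x₁ w₁ (collapseMap u' u z) = collapseMap x₂ w₂ (collapseMap v' v z)
  rel : ∀ r : ℕ → ℕ → Prop, Equivalence r → r u' u → r v' v → r x₁ w₁
  fix₁ : collapseMap u' u x₁ = x₁ ∧ collapseMap u' u w₁ = w₁
  fix₂ : collapseMap v' v x₂ = x₂ ∧ collapseMap v' v w₂ = w₂
  le₁ : w₁ ≤ x₁
  le₂ : w₂ ≤ x₂
  mem_x₁ : x₁ = u' ∨ x₁ = u ∨ x₁ = v' ∨ x₁ = v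
  mem_w₁ : w₁ = u ∨ w₁ = v
  mem_x₂ : x₂ = u' ∨ x₂ = u ∨ x₂ = v' ∨ x₂ = v
  mem_w₂ : w₂ = u ∨ w₂ = v

theorem exists_closesSpan {u' u v' v : ℕ} (hu : u ≤ u') (hv : v ≤ v') :
    ∃ x₁ w₁ x₂ w₂, ClosesSpan u' u v' v x₁ w₁ x₂ w₂ := by
  by_cases h1 : u' = u
  · exact ⟨v', v, v, v, by constructor <;> grind [collapseMap]⟩
  by_cases h2 : v' = v
  · refine ⟨u, u, u', u, ?_, fun r hr _ _ => hr.refl u, ?_, ?_, ?_, ?_, ?_, ?_, ?_, ?_⟩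
      <;> grind [collapseMap]
  by_cases h3 : u' = v'
  · subst h3
    rcases le_total u v with h | h
    · refine ⟨v, u, v, u, ?_, fun r hr a b => hr.trans (hr.symm b) a, ?_, ?_, ?_, ?_, ?_, ?_, ?_, ?_⟩
        <;> grind [collapseMap]
    · refine ⟨u, v, u, v, ?_, fun r hr a b => hr.trans (hr.symm a) b, ?_, ?_, ?_, ?_, ?_, ?_, ?_, ?_⟩
        <;> grind [collapseMap]
  by_cases h4 : u = v'
  · exact ⟨u, v, u', v, by constructor <;> grind [collapseMap]⟩
  by_cases h5 : v = u'
  · refine ⟨v', u, v, u, ?_, fun r hr a b => hr.trans b (h5 ▸ a), ?_, ?_, ?_, ?_, ?_, ?_, ?_, ?_⟩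
      <;> grind [collapseMap]
  · exact ⟨v', v, u', u, by constructor <;> grind [collapseMap]⟩

/-- Diamond property of the single-step folding approximations:
if `S ⊒_{u',u} T₁` and `S ⊒_{v',v} T₂`, then there are a term graph `U` and
`w₁, w₂ ∈ {u, v}` with `T₁ ⊒_{·,w₁} U` and `T₂ ⊒_{·,w₂} U`. -/
theorem collapse_diamond {F V : Type} (ar : F → ℕ)
    (S T₁ T₂ : PreGraph (F ⊕ V))
    (hS : IsTermGraph ar S) (hT₁ : IsTermGraph ar T₁) (hT₂ : IsTermGraph ar T₂)
    (u' u v' v : ℕ) (h1 : Collapse S T₁ u' u) (h2 : Collapse S T₂ v' v) :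
    ∃ U : PreGraph (F ⊕ V), IsTermGraph ar U ∧
      ∃ w₁ ∈ ({u, v} : Set ℕ), ∃ w₂ ∈ ({u, v} : Set ℕ),
        (∃ x, Collapse T₁ U x w₁) ∧ (∃ x, Collapse T₂ U x w₂) := by
  obtain ⟨hu', hu, hle1, hm1⟩ := h1
  obtain ⟨hv', hv, hle2, hm2⟩ := h2
  change IsGeMorph S T₁ (collapseMap u' u) at hm1
  change IsGeMorph S T₂ (collapseMap v' v) at hm2
  obtain ⟨x₁, w₁, x₂, w₂, H⟩ := exists_closesSpan hle1 hle2
  set m : ℕ → ℕ := fun z => collapseMap x₁ w₁ (collapseMap u' u z)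
  have hcomm : ∀ z, collapseMap x₂ w₂ (collapseMap v' v z) = m z := fun z => (H.comm z).symm
  have rel : ∀ r : ℕ → ℕ → Prop, Equivalence r → r u' u → r v' v → ∀ z, r z (m z) :=
    fun r hr a b z => hr.trans (collapseMap_rel hr a z) (collapseMap_rel hr (H.rel r hr a b) _)
  have hmem : ∀ z ∈ S.nodes, m z ∈ S.nodes := fun z hz =>
    (rel (fun a b => a ∈ S.nodes ↔ b ∈ S.nodes)
      ⟨fun _ => Iff.rfl, Iff.symm, Iff.trans⟩ (iff_of_true hu' hu) (iff_of_true hv' hv) z).1 hz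
  have hlab : ∀ z ∈ S.nodes, S.lab (m z) = S.lab z := fun z _ =>
    (rel (fun a b => S.lab a = S.lab b) (eq_equivalence.comap S.lab)
      (by rw [← hm1.lab u' hu', ← hm1.lab u hu]; simp [collapseMap])
      (by rw [← hm2.lab v' hv', ← hm2.lab v hv]; simp [collapseMap]) z).symm
  have hsuc : ∀ z ∈ S.nodes, (S.suc (m z)).map m = (S.suc z).map m := fun z _ => by
    refine (rel (fun a b => (S.suc a).map m = (S.suc b).map m)
      (eq_equivalence.comap fun a => (S.suc a).map m) ?_ ?_ z).symm
    · have h : (S.suc u').map (collapseMap u' u) = (S.suc u).map (collapseMap u' u) := by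
        rw [← hm1.suc u' hu', ← hm1.suc u hu]; simp [collapseMap]
      simpa [List.map_map, Function.comp_def] using congrArg (List.map (collapseMap x₁ w₁)) h
    · have h : (S.suc v').map (collapseMap v' v) = (S.suc v).map (collapseMap v' v) := by
        rw [← hm2.suc v' hv', ← hm2.suc v hv]; simp [collapseMap]
      simpa [List.map_map, Function.comp_def, hcomm] using
        congrArg (List.map (collapseMap x₂ w₂)) h
  have hU := imageGraph_isGeMorph hlab hsuc
  have mem_S {x : ℕ} (hx : x = u' ∨ x = u ∨ x = v' ∨ x = v) : x ∈ S.nodes := by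
    rcases hx with rfl | rfl | rfl | rfl <;> assumption
  have mem_S' {x : ℕ} (hx : x = u ∨ x = v) : x ∈ S.nodes := by
    rcases hx with rfl | rfl <;> assumption
  refine ⟨imageGraph S m, imageGraph_isTermGraph hS hmem hU, w₁, H.mem_w₁, w₂, H.mem_w₂,
    ⟨x₁, ?_, ?_, H.le₁, hm1.factor hS hT₁ hU fun _ => rfl⟩,
    ⟨x₂, ?_, ?_, H.le₂, hm2.factor hS hT₂ hU hcomm⟩⟩
  · exact H.fix₁.1 ▸ hm1.maps x₁ (mem_S H.mem_x₁)
  · exact H.fix₁.2 ▸ hm1.maps w₁ (mem_S' H.mem_w₁)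
  · exact H.fix₂.1 ▸ hm2.maps x₂ (mem_S H.mem_x₂)
  · exact H.fix₂.2 ▸ hm2.maps w₂ (mem_S' H.mem_w₂)

end TermGraphs
end
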